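/- arXiv:math/0612085 — 2 statements merged into one kernel-verified Lean document; each statement's English description precedes it below -/
import Mathlib

section
/- For every integer p ≥ 2, the p-adic solenoid Σ_p — the subspace of the countable product of copies of the circle {z ∈ ℂ : |z| = 1} consisting of all sequences (z_0, z_1, z_2, …) with z_{n+1}^p = z_n for every n — admits no topological embedding into ℝ². -/
open Topology Metric

/-- The `p`-adic solenoid: sequences `(z_0, z_1, …)` of points of the unit circle in `ℂ`
with `z_{n+1}^p = z_n` for all `n`, topologized as a subspace of the product of circles. -/
def Solenoid (p : ℕ) : Type :=
  {z : ℕ → {w : ℂ // ‖w‖ = 1} // ∀ n : ℕ, ((z (n + 1) : ℂ)) ^ p = (z n : ℂ)}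

instance (p : ℕ) : TopologicalSpace (Solenoid p) :=
  inferInstanceAs (TopologicalSpace
    {z : ℕ → {w : ℂ // ‖w‖ = 1} // ∀ n : ℕ, ((z (n + 1) : ℂ)) ^ p = (z n : ℂ)})

/-- `f` has a continuous logarithm on `S`. -/
def HasLogOn (f : ℂ → ℂ) (S : Set ℂ) : Prop :=
  ∃ g : ℂ → ℂ, ContinuousOn g S ∧ ∀ z ∈ S, Complex.exp (g z) = f z

namespace HasLogOn

variable {f h : ℂ → ℂ} {S T : Set ℂ}

theorem mono (hf : HasLogOn f S) (hTS : T ⊆ S) : HasLogOn f T := by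
  obtain ⟨g, hg, hgf⟩ := hf
  exact ⟨g, hg.mono hTS, fun z hz => hgf z (hTS hz)⟩

theorem congr (hf : HasLogOn f S) (hfh : ∀ z ∈ S, h z = f z) : HasLogOn h S := by
  obtain ⟨g, hg, hgf⟩ := hf
  exact ⟨g, hg, fun z hz => (hgf z hz).trans (hfh z hz).symm⟩

theorem const {c : ℂ} (hc : c ≠ 0) (S : Set ℂ) : HasLogOn (fun _ => c) S :=
  ⟨fun _ => Complex.log c, continuousOn_const, fun _ _ => Complex.exp_log hc⟩

theorem mul (hf : HasLogOn f S) (hh : HasLogOn h S) : HasLogOn (fun z => f z * h z) S := by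
  obtain ⟨g, hg, hgf⟩ := hf
  obtain ⟨k, hk, hkh⟩ := hh
  exact ⟨fun z => g z + k z, hg.add hk, fun z hz => by
    rw [Complex.exp_add, hgf z hz, hkh z hz]⟩

theorem zpow (hf : HasLogOn f S) (n : ℤ) : HasLogOn (fun z => f z ^ n) S := by
  obtain ⟨g, hg, hgf⟩ := hf
  exact ⟨fun z => n * g z, continuousOn_const.mul hg, fun z hz => by
    rw [Complex.exp_int_mul, hgf z hz]⟩

theorem inv (hf : HasLogOn f S) : HasLogOn (fun z => (f z)⁻¹) S := by
  simpa using hf.zpow (-1)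

theorem div (hf : HasLogOn f S) (hh : HasLogOn h S) : HasLogOn (fun z => f z / h z) S := by
  simpa only [div_eq_mul_inv] using hf.mul hh.inv

theorem prod {ι : Type*} (s : Finset ι) {F : ι → ℂ → ℂ} (hF : ∀ i ∈ s, HasLogOn (F i) S) :
    HasLogOn (fun z => ∏ i ∈ s, F i z) S := by
  classical
  induction s using Finset.induction_on with
  | empty => simpa using const one_ne_zero S
  | insert a s ha ih =>
    simp only [Finset.prod_insert ha]
    exact (hF a (Finset.mem_insert_self a s)).mul
      (ih fun i hi => hF i (Finset.mem_insert_of_mem hi))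

theorem of_slitPlane (hf : ContinuousOn f S) (hS : ∀ z ∈ S, f z ∈ Complex.slitPlane) :
    HasLogOn f S :=
  ⟨fun z => Complex.log (f z), hf.clog hS,
    fun z hz => Complex.exp_log (Complex.slitPlane_ne_zero (hS z hz))⟩

theorem of_empty (hS : S = ∅) : HasLogOn f S :=
  ⟨0, by simp [hS], by simp [hS]⟩

end HasLogOn

/-- Two continuous logarithms that agree on the overlap of two closed sets glue together. -/
theorem hasLogOn_union_of_eqOn {f g k : ℂ → ℂ} {A B : Set ℂ} (hA : IsClosed A) (hB : IsClosed B)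
    (hg : ContinuousOn g A) (hgf : ∀ z ∈ A, Complex.exp (g z) = f z)
    (hk : ContinuousOn k B) (hkf : ∀ z ∈ B, Complex.exp (k z) = f z)
    (hgk : ∀ z ∈ A, z ∈ B → g z = k z) : HasLogOn f (A ∪ B) := by
  classical
  have hB' : ∀ z ∈ B, A.piecewise g k z = k z := fun z hz => by
    by_cases hzA : z ∈ A
    · rw [Set.piecewise_eq_of_mem _ _ _ hzA, hgk z hzA hz]
    · exact Set.piecewise_eq_of_notMem _ _ _ hzA
  have hA' : ∀ z ∈ A, A.piecewise g k z = g z := fun z hz => Set.piecewise_eq_of_mem _ _ _ hz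
  refine ⟨A.piecewise g k, (hg.congr hA').union_of_isClosed (hk.congr hB') hA hB, ?_⟩
  rintro z (hz | hz)
  · rw [hA' z hz, hgf z hz]
  · rw [hB' z hz, hkf z hz]

theorem HasLogOn.union_of_subsingleton {f : ℂ → ℂ} {A B : Set ℂ} (hA : IsClosed A)
    (hB : IsClosed B) (hfA : HasLogOn f A) (hfB : HasLogOn f B) (hAB : (A ∩ B).Subsingleton) :
    HasLogOn f (A ∪ B) := by
  obtain ⟨g, hg, hgf⟩ := hfA
  obtain ⟨k, hk, hkf⟩ := hfB
  rcases hAB.eq_empty_or_singleton with h | ⟨w, hw⟩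
  · exact hasLogOn_union_of_eqOn hA hB hg hgf hk hkf fun z hzA hzB =>
      absurd (h.subset ⟨hzA, hzB⟩) (Set.notMem_empty z)
  · have hwAB : w ∈ A ∩ B := by simp [hw]
    refine hasLogOn_union_of_eqOn hA hB hg hgf (k := fun z => k z + (g w - k w))
      (hk.add continuousOn_const) (fun z hz => ?_) fun z hzA hzB => ?_
    · rw [Complex.exp_add, Complex.exp_sub, hgf w hwAB.1, hkf w hwAB.2, hkf z hz, div_self, mul_one]
      rw [← hkf w hwAB.2]
      exact Complex.exp_ne_zero _
    · have : z = w := hw.subset ⟨hzA, hzB⟩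
      rw [this]; ring

theorem exists_ball_hasLogOn {f : ℂ → ℂ} {S : Set ℂ} (hS : IsClosed S) (hf : ContinuousOn f S)
    (h0 : ∀ z ∈ S, f z ≠ 0) (w : ℂ) : ∃ δ > 0, HasLogOn f (S ∩ ball w δ) := by
  by_cases hw : w ∈ S
  · have hfw : ContinuousWithinAt (fun z => f z / f w) S w := (hf w hw).div_const _
    have : (fun z => f z / f w) ⁻¹' Complex.slitPlane ∈ 𝓝[S] w := by
      refine hfw.preimage_mem_nhdsWithin (Complex.isOpen_slitPlane.mem_nhds ?_)
      simp [div_self (h0 w hw)]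
    obtain ⟨δ, hδ, hsub⟩ := Metric.mem_nhdsWithin_iff.1 this
    refine ⟨δ, hδ, ?_⟩
    have h1 : HasLogOn (fun z => f z / f w) (S ∩ ball w δ) :=
      .of_slitPlane ((hf.mono Set.inter_subset_left).div_const _) fun z hz => hsub ⟨hz.2, hz.1⟩
    refine (h1.mul (.const (h0 w hw) _)).congr fun z _ => ?_
    rw [div_mul_cancel₀ _ (h0 w hw)]
  · obtain ⟨δ, hδ, hsub⟩ := Metric.isOpen_iff.1 hS.isOpen_compl w hw
    exact ⟨δ, hδ, .of_empty (Set.eq_empty_of_forall_notMem fun z hz => hsub hz.2 hz.1)⟩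

/-- Induction along a real interval: a property that propagates to the right locally, uniformly near
every point, propagates from `a` to `b`. -/
theorem real_induction {P : ℝ → Prop} {a b : ℝ} (hab : a ≤ b) (ha : P a)
    (h : ∀ c, ∃ δ > 0, ∀ x y, c - δ < x → x ≤ y → y < c + δ → P x → P y) : P b := by
  set S : Set ℝ := {x | x ∈ Set.Icc a b ∧ P x} with hS
  have hne : S.Nonempty := ⟨a, ⟨le_rfl, hab⟩, ha⟩
  have hbdd : BddAbove S := ⟨b, fun x hx => hx.1.2⟩
  obtain ⟨δ, hδ, hstep⟩ := h (sSup S)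
  obtain ⟨x, hx, hxc⟩ := exists_lt_of_lt_csSup hne (sub_lt_self (sSup S) hδ)
  have hxs : x ≤ sSup S := le_csSup hbdd hx
  have hxy : x ≤ min b (sSup S + δ / 2) := le_min hx.1.2 (by linarith)
  have hP : P (min b (sSup S + δ / 2)) :=
    hstep x _ hxc hxy ((min_le_right _ _).trans_lt (by linarith)) hx.2
  have hle : min b (sSup S + δ / 2) ≤ sSup S :=
    le_csSup hbdd ⟨⟨hx.1.1.trans hxy, min_le_left _ _⟩, hP⟩
  rcases min_choice b (sSup S + δ / 2) with hm | hm
  · rwa [hm] at hP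
  · rw [hm] at hle; linarith

theorem hasLogOn_vertical_slice {f : ℂ → ℂ} {K : Set ℂ} (hK : IsCompact K)
    (hf : ContinuousOn f K) (h0 : ∀ z ∈ K, f z ≠ 0) (c : ℝ) :
    HasLogOn f (K ∩ {z | z.re = c}) := by
  obtain ⟨r, hr⟩ := hK.isBounded.subset_closedBall 0
  have him : ∀ z ∈ K, |z.im| ≤ r := fun z hz =>
    (Complex.abs_im_le_norm z).trans (by simpa using hr hz)
  set T : Set ℂ := K ∩ {z | z.re = c} with hT
  have hTc : IsClosed T := hK.isClosed.inter (isClosed_eq Complex.continuous_re continuous_const)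
  have key : HasLogOn f (T ∩ {z | z.im ≤ max (-r - 1) r}) := by
    refine real_induction (P := fun y => HasLogOn f (T ∩ {z | z.im ≤ y})) (le_max_left _ _)
      (.of_empty (Set.eq_empty_of_forall_notMem ?_)) fun y₀ => ?_
    · rintro z ⟨hz, hzy⟩
      have := abs_le.1 (him z hz.1)
      simp only [Set.mem_ofPred_eq] at hzy
      linarith
    · obtain ⟨δ, hδ, hlog⟩ := exists_ball_hasLogOn hTc (hf.mono Set.inter_subset_left)
        (fun z hz => h0 z hz.1) ⟨c, y₀⟩
      refine ⟨δ, hδ, fun x y hx hxy hy hP => ?_⟩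
      have hB : HasLogOn f (T ∩ {z | x ≤ z.im ∧ z.im ≤ y}) := by
        refine hlog.mono fun z hz => ⟨hz.1, ?_⟩
        have hzc : z - ⟨c, y₀⟩ = (z.im - y₀ : ℝ) * Complex.I := by
          apply Complex.ext <;> simp [show z.re = c from hz.1.2]
        rw [mem_ball, dist_eq_norm, hzc, norm_mul, Complex.norm_I, mul_one, Complex.norm_real,
          Real.norm_eq_abs, abs_lt]
        constructor <;> linarith [hz.2.1, hz.2.2]
      refine (hP.union_of_subsingleton ?_ ?_ hB ?_).mono ?_
      · exact hTc.inter (isClosed_le Complex.continuous_im continuous_const)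
      · exact hTc.inter ((isClosed_le continuous_const Complex.continuous_im).inter
          (isClosed_le Complex.continuous_im continuous_const))
      · rintro z ⟨hz, hz'⟩ w ⟨hw, hw'⟩
        apply Complex.ext
        · rw [show z.re = c from hz.1.2, show w.re = c from hw.1.2]
        · rw [le_antisymm hz.2 hz'.2.1, le_antisymm hw.2 hw'.2.1]
      · intro z hz
        rcases le_total z.im x with h | h
        · exact .inl ⟨hz.1, h⟩
        · exact .inr ⟨hz.1, h, hz.2⟩
  exact key.mono fun z hz => ⟨hz, (abs_le.1 (him z hz.1)).2.trans (le_max_right _ _)⟩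

theorem exists_continuous_extension {g : ℂ → ℂ} {S : Set ℂ} (hS : IsClosed S)
    (hg : ContinuousOn g S) : ∃ G : ℂ → ℂ, Continuous G ∧ ∀ z ∈ S, G z = g z := by
  obtain ⟨G, hG⟩ := ContinuousMap.exists_restrict_eq hS ⟨S.domRestrict g, hg.domRestrict⟩
  exact ⟨G, G.continuous, fun z hz => congrArg (fun F : C(S, ℂ) => F ⟨z, hz⟩) hG⟩

theorem exists_strip_hasLogOn {f : ℂ → ℂ} {K : Set ℂ} (hK : IsCompact K)
    (hf : ContinuousOn f K) (h0 : ∀ z ∈ K, f z ≠ 0) (c : ℝ) :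
    ∃ δ > 0, HasLogOn f (K ∩ {z | |z.re - c| < δ}) := by
  obtain ⟨g, hg, hgf⟩ := hasLogOn_vertical_slice hK hf h0 c
  obtain ⟨G, hG, hGg⟩ := exists_continuous_extension
    (hK.isClosed.inter (isClosed_eq Complex.continuous_re continuous_const)) hg
  have hF : ContinuousOn (fun z => f z / Complex.exp (G z)) K :=
    hf.div (Complex.continuous_exp.comp hG).continuousOn fun z _ => Complex.exp_ne_zero _
  obtain ⟨O, hO, hOK⟩ := continuousOn_iff'.1 hF _ Complex.isOpen_slitPlane
  have hKO : IsCompact ((fun z : ℂ => z.re - c) '' (K \ O)) :=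
    (hK.diff hO).image (Complex.continuous_re.sub continuous_const)
  have h0mem : (0 : ℝ) ∉ (fun z : ℂ => z.re - c) '' (K \ O) := by
    rintro ⟨z, ⟨hzK, hzO⟩, hz⟩
    have hzT : z ∈ K ∩ {z | z.re = c} := ⟨hzK, sub_eq_zero.1 hz⟩
    refine hzO ((hOK.subset ⟨?_, hzK⟩).1)
    simp [hGg z hzT, hgf z hzT, div_self (h0 z hzK)]
  obtain ⟨δ, hδ, hsub⟩ := Metric.isOpen_iff.1 hKO.isClosed.isOpen_compl 0 h0mem
  refine ⟨δ, hδ, ?_⟩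
  have h1 : HasLogOn (fun z => f z / Complex.exp (G z)) (K ∩ {z | |z.re - c| < δ}) := by
    refine .of_slitPlane (hF.mono Set.inter_subset_left) fun z hz => ?_
    have hzO : z ∈ O := by
      by_contra hzO
      refine hsub (a := z.re - c) (by simpa using hz.2) ⟨z, ⟨hz.1, hzO⟩, rfl⟩
    exact (hOK.superset ⟨hzO, hz.1⟩).1
  refine (h1.mul ⟨G, hG.continuousOn, fun z _ => rfl⟩).congr fun z _ => ?_
  rw [div_mul_cancel₀ _ (Complex.exp_ne_zero _)]

/-- The rational function with divisor `m`. -/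
noncomputable def ratProd (m : ℂ →₀ ℤ) (z : ℂ) : ℂ := m.prod fun a n => (z - a) ^ n

section ratProd

variable {m m' : ℂ →₀ ℤ} {z : ℂ} {S : Set ℂ}

theorem ratProd_ne_zero (hz : z ∉ m.support) : ratProd m z ≠ 0 :=
  Finset.prod_ne_zero_iff.2 fun _ ha =>
    zpow_ne_zero _ (sub_ne_zero.2 fun h => hz (h ▸ ha))

theorem ratProd_add (hz : z ∉ m.support) (hz' : z ∉ m'.support) :
    ratProd (m + m') z = ratProd m z * ratProd m' z := by
  classical
  refine Finsupp.prod_add_index (fun a _ => zpow_zero _) fun a ha b c => zpow_add₀ ?_ b c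
  rcases Finset.mem_union.1 ha with h | h
  · exact sub_ne_zero.2 fun e => hz (e ▸ h)
  · exact sub_ne_zero.2 fun e => hz' (e ▸ h)

theorem ratProd_zsmul (q : ℤ) (m : ℂ →₀ ℤ) (z : ℂ) : ratProd (q • m) z = ratProd m z ^ q := by
  unfold ratProd
  rw [Finsupp.prod_of_support_subset _ Finsupp.support_smul _ fun a _ => zpow_zero _,
    Finsupp.prod, ← Finset.prod_zpow]
  refine Finset.prod_congr rfl fun a _ => ?_
  rw [Finsupp.smul_apply, smul_eq_mul, mul_comm, zpow_mul]

theorem hasLogOn_ratProd (h : ∀ a ∈ m.support, HasLogOn (fun z => z - a) S) :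
    HasLogOn (ratProd m) S :=
  HasLogOn.prod _ fun a ha => (h a ha).zpow (m a)

theorem continuousOn_ratProd (h : ∀ a ∈ m.support, a ∉ S) : ContinuousOn (ratProd m) S :=
  continuousOn_finsetProd _ fun a ha =>
    (continuousOn_id.sub continuousOn_const).zpow₀ _ fun z hz =>
      .inl (sub_ne_zero.2 fun e : z = a => h a ha (e ▸ hz))

end ratProd

theorem mem_slitPlane_of_re_nonneg {w : ℂ} (h0 : w ≠ 0) (h : 0 ≤ w.re) :
    w ∈ Complex.slitPlane := by
  rw [Complex.mem_slitPlane_iff]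
  rcases h.lt_or_eq with h | h
  · exact .inl h
  · exact .inr fun hi => h0 (Complex.ext h.symm hi)

theorem exists_continuous_log_sub_right {S : Set ℂ} {a : ℂ} (ha : a ∉ S)
    (hS : ∀ z ∈ S, a.re ≤ z.re) : ContinuousOn (fun z => Complex.log (z - a)) S ∧
      ∀ z ∈ S, Complex.exp (Complex.log (z - a)) = z - a := by
  have h : ∀ z ∈ S, z - a ≠ 0 := fun z hz => sub_ne_zero.2 fun e => ha (e ▸ hz)
  exact ⟨(continuousOn_id.sub continuousOn_const).clog fun z hz =>
    mem_slitPlane_of_re_nonneg (h z hz) (by simpa using hS z hz),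
    fun z hz => Complex.exp_log (h z hz)⟩

theorem exists_continuous_log_sub_left {S : Set ℂ} {a : ℂ} (ha : a ∉ S)
    (hS : ∀ z ∈ S, z.re ≤ a.re) :
    ContinuousOn (fun z => Complex.log (a - z) - Real.pi * Complex.I) S ∧
      ∀ z ∈ S, Complex.exp (Complex.log (a - z) - Real.pi * Complex.I) = z - a := by
  have h : ∀ z ∈ S, a - z ≠ 0 := fun z hz => sub_ne_zero.2 fun e => ha (e ▸ hz)
  refine ⟨((continuousOn_const.sub continuousOn_id).clog fun z hz =>
    mem_slitPlane_of_re_nonneg (h z hz) (by simpa using hS z hz)).sub continuousOn_const,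
    fun z hz => ?_⟩
  rw [Complex.exp_sub, Complex.exp_log (h z hz), Complex.exp_pi_mul_I]
  ring

theorem log_sub_sub_log_sub {z a : ℂ} (hre : z.re = a.re) (hne : z ≠ a) :
    Complex.log (z - a) - (Complex.log (a - z) - Real.pi * Complex.I) =
      ((if a.im < z.im then 1 else 0 : ℤ) : ℂ) * (2 * Real.pi * Complex.I) := by
  have him : z.im ≠ a.im := fun h => hne (Complex.ext hre h)
  have hn : ‖z - a‖ = ‖a - z‖ := norm_sub_rev z a
  have key : (z - a).arg - (a - z).arg + Real.pi =
      ((if a.im < z.im then 1 else 0 : ℤ) : ℝ) * (2 * Real.pi) := by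
    rcases lt_or_gt_of_ne him with h | h
    · rw [if_neg h.not_gt, Complex.arg_eq_neg_pi_div_two_iff (z := z - a) |>.2,
        Complex.arg_eq_pi_div_two_iff (z := a - z) |>.2]
      · push_cast; ring
      all_goals simp [hre, h]
    · rw [if_pos h, Complex.arg_eq_pi_div_two_iff (z := z - a) |>.2,
        Complex.arg_eq_neg_pi_div_two_iff (z := a - z) |>.2]
      · push_cast; ring
      all_goals simp [hre, h]
  have key' := congrArg (fun x : ℝ => (x : ℂ)) key
  simp only [Complex.ofReal_add, Complex.ofReal_sub, Complex.ofReal_mul, Complex.ofReal_intCast,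
    Complex.ofReal_ofNat] at key'
  rw [Complex.log, Complex.log, hn]
  linear_combination Complex.I * key'

/-- A locally constant integer function on the slice of a compact set by a vertical line is a
step function with jumps off the set. -/
theorem exists_step_function {K : Set ℂ} (hK : IsCompact K) (c : ℝ) {d : ℂ → ℤ}
    (hd : ∀ w ∈ K ∩ {z | z.re = c}, ∃ δ > 0, ∀ z ∈ K ∩ {z | z.re = c}, dist z w < δ → d z = d w) :
    ∃ m : ℂ →₀ ℤ, (∀ a ∈ m.support, a ∉ K ∧ a.re = c) ∧
      ∀ z ∈ K ∩ {z | z.re = c}, d z = m.sum fun a n => n * if a.im < z.im then 1 else 0 := by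
  classical
  obtain ⟨r, hr⟩ := hK.isBounded.subset_closedBall 0
  have him : ∀ z ∈ K, |z.im| ≤ r := fun z hz =>
    (Complex.abs_im_le_norm z).trans (by simpa using hr hz)
  have hline : ∀ z : ℂ, z.re = c → ∀ y : ℝ, dist z ⟨c, y⟩ = |z.im - y| := fun z hz y => by
    rw [Complex.dist_of_re_eq (by simpa using hz), Real.dist_eq]
  have hgap : ∀ y : ℝ, (⟨c, y⟩ : ℂ) ∉ K →
      ∃ δ > 0, ∀ z : ℂ, z.re = c → |z.im - y| < δ → z ∉ K := fun y hy => by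
    obtain ⟨δ, hδ, hsub⟩ := Metric.isOpen_iff.1 hK.isClosed.isOpen_compl _ hy
    exact ⟨δ, hδ, fun z hz hzy => hsub (by rwa [mem_ball, hline z hz])⟩
  suffices H : ∃ m : ℂ →₀ ℤ, (∀ a ∈ m.support, a ∉ K ∧ a.re = c ∧ a.im < max (-r - 1) r) ∧
      ∀ z ∈ K ∩ {z | z.re = c}, z.im ≤ max (-r - 1) r →
        d z = m.sum fun a n => n * if a.im < z.im then 1 else 0 by
    obtain ⟨m, hm, h⟩ := H
    exact ⟨m, fun a ha => ⟨(hm a ha).1, (hm a ha).2.1⟩, fun z hz =>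
      h z hz ((abs_le.1 (him z hz.1)).2.trans (le_max_right _ _))⟩
  refine real_induction (P := fun y => ∃ m : ℂ →₀ ℤ,
      (∀ a ∈ m.support, a ∉ K ∧ a.re = c ∧ a.im < y) ∧
      ∀ z ∈ K ∩ {z | z.re = c}, z.im ≤ y →
        d z = m.sum fun a n => n * if a.im < z.im then 1 else 0)
    (le_max_left (-r - 1) r) ⟨0, by simp, fun z hz hzy => ?_⟩ fun y₀ => ?_
  · have := abs_le.1 (him z hz.1)
    linarith
  obtain ⟨δ, hδ, k, hk⟩ : ∃ δ > 0, ∃ k : ℤ,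
      ∀ z ∈ K ∩ {z | z.re = c}, |z.im - y₀| < δ → d z = k := by
    by_cases hy : (⟨c, y₀⟩ : ℂ) ∈ K
    · obtain ⟨δ, hδ, h⟩ := hd ⟨c, y₀⟩ ⟨hy, rfl⟩
      exact ⟨δ, hδ, _, fun z hz hzy => h z hz (by rwa [hline z hz.2])⟩
    · obtain ⟨δ, hδ, h⟩ := hgap y₀ hy
      exact ⟨δ, hδ, 0, fun z hz hzy => absurd hz.1 (h z hz.2 hzy)⟩
  refine ⟨δ, hδ, fun x y hx hxy hy ⟨m, hm, hmd⟩ => ?_⟩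
  have htotal : ∀ z : ℂ, x ≤ z.im →
      (m.sum fun a n => n * if a.im < z.im then 1 else 0) = m.sum fun _ n => n := fun z hz =>
    Finsupp.sum_congr fun a ha => by rw [if_pos ((hm a ha).2.2.trans_le hz), mul_one]
  have hk' : ∀ z ∈ K ∩ {z | z.re = c}, x ≤ z.im → z.im ≤ y → d z = k := fun z hz h1 h2 =>
    hk z hz (abs_lt.2 ⟨by linarith, by linarith⟩)
  by_cases hxK : (⟨c, x⟩ : ℂ) ∈ K
  · refine ⟨m, fun a ha => ⟨(hm a ha).1, (hm a ha).2.1, (hm a ha).2.2.trans_le hxy⟩,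
      fun z hz hzy => ?_⟩
    rcases le_total z.im x with h | h
    · exact hmd z hz h
    · rw [hk' z hz h hzy, htotal z h, ← htotal ⟨c, x⟩ le_rfl, ← hmd ⟨c, x⟩ ⟨hxK, rfl⟩ le_rfl,
        hk' ⟨c, x⟩ ⟨hxK, rfl⟩ le_rfl hxy]
  · obtain ⟨ε, hε, hgapx⟩ := hgap x hxK
    set b : ℂ := ⟨c, x - ε / 2⟩ with hb
    have hbre : b.re = c := rfl
    have hbim : b.im = x - ε / 2 := rfl
    have hsum : ∀ z : ℂ, ((m + Finsupp.single b (k - m.sum fun _ n => n)).sum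
        fun a n => n * if a.im < z.im then 1 else 0) =
        (m.sum fun a n => n * if a.im < z.im then 1 else 0) +
          (k - m.sum fun _ n => n) * if b.im < z.im then 1 else 0 := fun z => by
      rw [Finsupp.sum_add_index' (by simp) (by intros; ring), Finsupp.sum_single_index (by simp)]
    refine ⟨m + Finsupp.single b (k - m.sum fun _ n => n), fun a ha => ?_, fun z hz hzy => ?_⟩
    · rcases Finset.mem_union.1 (Finsupp.support_add ha) with h | h
      · exact ⟨(hm a h).1, (hm a h).2.1, (hm a h).2.2.trans_le hxy⟩
      · obtain rfl : a = b := by simpa using Finsupp.support_single_subset h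
        refine ⟨hgapx _ hbre ?_, hbre, by rw [hbim]; linarith⟩
        rw [hbim, abs_lt]; constructor <;> linarith
    · rw [hsum]
      rcases le_total z.im x with h | h
      · have : ¬ b.im < z.im := fun hlt => by
          refine hgapx z hz.2 ?_ hz.1
          rw [abs_lt]; constructor <;> linarith
        rw [if_neg this, mul_zero, add_zero, hmd z hz h]
      · rw [htotal z h, if_pos (by rw [hbim]; linarith), hk' z hz h hzy]
        ring

theorem exists_ratProd_of_halves {f : ℂ → ℂ} {K : Set ℂ} (hK : IsCompact K) (c : ℝ)
    (hL : HasLogOn f (K ∩ {z | z.re ≤ c})) (hR : HasLogOn f (K ∩ {z | c ≤ z.re})) :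
    ∃ m : ℂ →₀ ℤ, (∀ a ∈ m.support, a ∉ K ∧ a.re = c) ∧
      HasLogOn (fun z => f z / ratProd m z) K := by
  obtain ⟨g, hg, hgf⟩ := hL
  obtain ⟨k, hk, hkf⟩ := hR
  have hL' : K ∩ {z | z.re = c} ⊆ K ∩ {z | z.re ≤ c} := fun z hz => ⟨hz.1, le_of_eq hz.2⟩
  have hR' : K ∩ {z | z.re = c} ⊆ K ∩ {z | c ≤ z.re} := fun z hz => ⟨hz.1, ge_of_eq hz.2⟩
  have hex : ∀ z : ℂ, ∃ n : ℤ, z ∈ K ∩ {z | z.re = c} →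
      k z = g z + n * (2 * Real.pi * Complex.I) := fun z => by
    by_cases hz : z ∈ K ∩ {z | z.re = c}
    · obtain ⟨n, hn⟩ := Complex.exp_eq_exp_iff_exists_int.1
        ((hkf z (hR' hz)).trans (hgf z (hL' hz)).symm)
      exact ⟨n, fun _ => hn⟩
    · exact ⟨0, fun h => absurd h hz⟩
  choose d hd using hex
  obtain ⟨m, hm, hmd⟩ := exists_step_function hK c (d := d) fun w hw => by
    have hcont : ContinuousOn (fun z => k z - g z) (K ∩ {z | z.re = c}) :=
      (hk.mono hR').sub (hg.mono hL')
    obtain ⟨δ, hδ, h⟩ := Metric.continuousOn_iff.1 hcont w hw _ Real.two_pi_pos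
    refine ⟨δ, hδ, fun z hz hzw => ?_⟩
    have := h z hz hzw
    rw [hd z hz, hd w hw, dist_eq_norm,
      show g z + d z * (2 * Real.pi * Complex.I) - g z -
        (g w + d w * (2 * Real.pi * Complex.I) - g w) =
        ((d z - d w : ℤ) : ℂ) * (2 * Real.pi * Complex.I) by push_cast; ring, norm_mul,
      Complex.norm_intCast] at this
    have hn : ‖(2 * Real.pi * Complex.I : ℂ)‖ = 2 * Real.pi := by
      simp [abs_of_pos Real.pi_pos]
    rw [hn, mul_lt_iff_lt_one_left Real.two_pi_pos] at this
    have h1 : |d z - d w| < 1 := by exact_mod_cast this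
    exact sub_eq_zero.1 (Int.abs_lt_one_iff.1 h1)
  refine ⟨m, hm, ?_⟩
  have hunion : K = (K ∩ {z | z.re ≤ c}) ∪ (K ∩ {z | c ≤ z.re}) := by
    rw [← Set.inter_union_distrib_left]
    exact (Set.inter_eq_left.2 fun z _ => le_total z.re c).symm
  rw [hunion]
  have hright : ∀ a ∈ m.support, _ := fun a ha =>
    exists_continuous_log_sub_right (S := K ∩ {z | c ≤ z.re}) (a := a)
      (fun h => (hm a ha).1 h.1) fun z hz => (hm a ha).2.trans_le hz.2
  have hleft : ∀ a ∈ m.support, _ := fun a ha =>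
    exists_continuous_log_sub_left (S := K ∩ {z | z.re ≤ c}) (a := a)
      (fun h => (hm a ha).1 h.1) fun z hz => hz.2.trans_eq (hm a ha).2.symm
  refine hasLogOn_union_of_eqOn
    (g := fun z => g z - ∑ a ∈ m.support, m a * (Complex.log (a - z) - Real.pi * Complex.I))
    (k := fun z => k z - ∑ a ∈ m.support, m a * Complex.log (z - a))
    (hK.isClosed.inter (isClosed_le Complex.continuous_re continuous_const))
    (hK.isClosed.inter (isClosed_le continuous_const Complex.continuous_re))
    (hg.sub (continuousOn_finsetSum _ fun a ha => continuousOn_const.mul (hleft a ha).1))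
    (fun z hz => ?_)
    (hk.sub (continuousOn_finsetSum _ fun a ha => continuousOn_const.mul (hright a ha).1))
    (fun z hz => ?_) fun z hzL hzR => ?_
  · rw [Complex.exp_sub, Complex.exp_sum, hgf z hz]
    congr 1
    exact Finset.prod_congr rfl fun a ha => by rw [Complex.exp_int_mul, (hleft a ha).2 z hz]
  · rw [Complex.exp_sub, Complex.exp_sum, hkf z hz]
    congr 1
    exact Finset.prod_congr rfl fun a ha => by rw [Complex.exp_int_mul, (hright a ha).2 z hz]
  · have hz : z ∈ K ∩ {z | z.re = c} := ⟨hzL.1, le_antisymm hzL.2 hzR.2⟩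
    have hsum : ∑ a ∈ m.support, m a * Complex.log (z - a) -
        ∑ a ∈ m.support, m a * (Complex.log (a - z) - Real.pi * Complex.I) =
        d z * (2 * Real.pi * Complex.I) := by
      rw [← Finset.sum_sub_distrib, hmd z hz, Finsupp.sum]
      push_cast
      rw [Finset.sum_mul]
      refine Finset.sum_congr rfl fun a ha => ?_
      rw [← mul_sub, log_sub_sub_log_sub (hz.2.trans (hm a ha).2.symm)
        fun e => (hm a ha).1 (e ▸ hz.1)]
      push_cast
      ring
    rw [hd z hz, ← hsum]
    ring

/-- On a compact plane set every continuous nonvanishing function is, up to an exponential, a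
rational function with divisor off the set. -/
theorem exists_ratProd_hasLogOn_div {f : ℂ → ℂ} {K : Set ℂ} (hK : IsCompact K)
    (hf : ContinuousOn f K) (h0 : ∀ z ∈ K, f z ≠ 0) :
    ∃ m : ℂ →₀ ℤ, (∀ a ∈ m.support, a ∉ K) ∧ HasLogOn (fun z => f z / ratProd m z) K := by
  obtain ⟨r, hr⟩ := hK.isBounded.subset_closedBall 0
  have hre : ∀ z ∈ K, |z.re| ≤ r := fun z hz =>
    (Complex.abs_re_le_norm z).trans (by simpa using hr hz)
  suffices H : ∃ m : ℂ →₀ ℤ, (∀ a ∈ m.support, a ∉ K ∧ a.re ≤ max (-r - 1) r) ∧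
      HasLogOn (fun z => f z / ratProd m z) (K ∩ {z | z.re ≤ max (-r - 1) r}) by
    obtain ⟨m, hm, h⟩ := H
    exact ⟨m, fun a ha => (hm a ha).1, h.mono fun z hz =>
      ⟨hz, (abs_le.1 (hre z hz)).2.trans (le_max_right _ _)⟩⟩
  refine real_induction (P := fun x => ∃ m : ℂ →₀ ℤ, (∀ a ∈ m.support, a ∉ K ∧ a.re ≤ x) ∧
      HasLogOn (fun z => f z / ratProd m z) (K ∩ {z | z.re ≤ x})) (le_max_left _ _)
    ⟨0, by simp, .of_empty (Set.eq_empty_of_forall_notMem ?_)⟩ fun c => ?_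
  · rintro z ⟨hz, hzx⟩
    have := abs_le.1 (hre z hz)
    simp only [Set.mem_ofPred_eq] at hzx
    linarith
  obtain ⟨δ, hδ, hlog⟩ := exists_strip_hasLogOn hK hf h0 c
  refine ⟨δ, hδ, fun x y hx hxy hy ⟨m, hm, hmlog⟩ => ?_⟩
  have hKy : IsCompact (K ∩ {z | z.re ≤ y}) :=
    hK.inter_right (isClosed_le Complex.continuous_re continuous_const)
  obtain ⟨m', hm', hm'log⟩ := exists_ratProd_of_halves (f := fun z => f z / ratProd m z) hKy x
    (hmlog.mono fun z hz => ⟨hz.1.1, hz.2⟩) (by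
      have hsub : K ∩ {z | z.re ≤ y} ∩ {z | x ≤ z.re} ⊆ K ∩ {z | |z.re - c| < δ} := by
        rintro z ⟨⟨hzK, hzy : z.re ≤ y⟩, hzx : x ≤ z.re⟩
        exact ⟨hzK, show |z.re - c| < δ from abs_lt.2 ⟨by linarith, by linarith⟩⟩
      exact (hlog.mono hsub).div
        (hasLogOn_ratProd fun a ha => ⟨_, exists_continuous_log_sub_right
          (fun h => (hm a ha).1 h.1.1) fun z hz => (hm a ha).2.trans hz.2⟩))
  have hm'K : ∀ a ∈ m'.support, a ∉ K ∧ a.re ≤ y := fun a ha =>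
    have hay := (hm' a ha).2.trans_le hxy
    ⟨fun h => (hm' a ha).1 ⟨h, hay⟩, hay⟩
  refine ⟨m + m', fun a ha => ?_, hm'log.congr fun z hz => ?_⟩
  · rcases Finset.mem_union.1 (Finsupp.support_add ha) with h | h
    · exact ⟨(hm a h).1, (hm a h).2.trans hxy⟩
    · exact hm'K a h
  · rw [ratProd_add (fun h => (hm z h).1 hz.1) fun h => (hm'K z h).1 hz.1, div_div]

theorem hasLogOn_sub_of_norm_lt {S : Set ℂ} {a : ℂ} (h : ∀ z ∈ S, ‖z‖ < ‖a‖) :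
    HasLogOn (fun z => z - a) S := by
  by_cases ha : a = 0
  · exact .of_empty (Set.eq_empty_of_forall_notMem fun z hz => by
      have := h z hz
      rw [ha, norm_zero] at this
      exact absurd this (norm_nonneg z).not_gt)
  · have h1 : HasLogOn (fun z => 1 + -(z / a)) S :=
      .of_slitPlane (by fun_prop) fun z hz => Complex.mem_slitPlane_of_norm_lt_one (by
        rw [norm_neg, norm_div, div_lt_one (norm_pos_iff.2 ha)]
        exact h z hz)
    refine (h1.mul (.const (neg_ne_zero.2 ha) S)).congr fun z _ => ?_
    field_simp
    ring

theorem hasLogOn_sub_div_sub {S : Set ℂ} {a b : ℂ} (h : ∀ z ∈ S, ‖b - a‖ < ‖z - b‖) :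
    HasLogOn (fun z => (z - a) / (z - b)) S := by
  have hne : ∀ z ∈ S, z - b ≠ 0 := fun z hz => norm_pos_iff.1 ((norm_nonneg _).trans_lt (h z hz))
  have h1 : HasLogOn (fun z => 1 + (b - a) / (z - b)) S :=
    .of_slitPlane (continuousOn_const.add (continuousOn_const.div (by fun_prop) hne))
      fun z hz => Complex.mem_slitPlane_of_norm_lt_one (by
        rw [norm_div, div_lt_one (norm_pos_iff.2 (hne z hz))]
        exact h z hz)
  refine h1.congr fun z hz => ?_
  have := hne z hz
  field_simp
  ring

theorem hasLogOn_closedBall {f : ℂ → ℂ} {r : ℝ} (hf : ContinuousOn f (closedBall 0 r))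
    (h0 : ∀ z ∈ closedBall 0 r, f z ≠ 0) : HasLogOn f (closedBall 0 r) := by
  obtain ⟨m, hm, h⟩ := exists_ratProd_hasLogOn_div (isCompact_closedBall 0 r) hf h0
  refine (h.mul (hasLogOn_ratProd fun a ha => hasLogOn_sub_of_norm_lt fun z hz => ?_)).congr
    fun z hz => (div_mul_cancel₀ _ (ratProd_ne_zero fun h => hm z h hz)).symm
  have := hm a ha
  rw [mem_closedBall_zero_iff] at this hz
  linarith

theorem eq_of_exp_eq_one {φ : ℝ → ℂ} (hφ : Continuous φ) (h : ∀ t, Complex.exp (φ t) = 1)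
    (s t : ℝ) : φ s = φ t := by
  refine IsLocallyConstant.apply_eq_of_isPreconnected
    (IsLocallyConstant.iff_eventually_eq φ |>.2 fun x => ?_) isPreconnected_univ
    (Set.mem_univ s) (Set.mem_univ t)
  filter_upwards [hφ.continuousAt.eventually (Metric.ball_mem_nhds (φ x) Real.two_pi_pos)]
    with y hy
  obtain ⟨n, hn⟩ := Complex.exp_eq_exp_iff_exists_int.1 ((h y).trans (h x).symm)
  rw [dist_eq_norm, hn, add_sub_cancel_left, norm_mul, Complex.norm_intCast] at hy
  have hnorm : ‖(2 * Real.pi * Complex.I : ℂ)‖ = 2 * Real.pi := by simp [abs_of_pos Real.pi_pos]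
  rw [hnorm, mul_lt_iff_lt_one_left Real.two_pi_pos] at hy
  have h1 : |n| < 1 := by exact_mod_cast hy
  rw [hn, Int.abs_lt_one_iff.1 h1]
  simp

theorem eq_zero_of_hasLogOn_zpow_sphere {r : ℝ} (hr : 0 < r) {N : ℤ}
    (h : HasLogOn (fun z => z ^ N) (sphere 0 r)) : N = 0 := by
  obtain ⟨g, hg, hgf⟩ := h
  have hmem : ∀ t : ℝ, (r : ℂ) * Complex.exp (t * Complex.I) ∈ sphere (0 : ℂ) r := fun t => by
    simp [abs_of_pos hr]
  have hr0 : (r : ℂ) ≠ 0 := by exact_mod_cast hr.ne'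
  have hconst := eq_of_exp_eq_one
    (φ := fun t : ℝ => g (r * Complex.exp (t * Complex.I)) -
      N * (Complex.log r + t * Complex.I))
    ((hg.comp_continuous (by fun_prop) hmem).sub (by fun_prop)) (fun t => by
      rw [Complex.exp_sub, hgf _ (hmem t), Complex.exp_int_mul, Complex.exp_add,
        Complex.exp_log hr0]
      exact div_self (zpow_ne_zero _ (mul_ne_zero hr0 (Complex.exp_ne_zero _)))) 0 (2 * Real.pi)
  simp only [Complex.ofReal_zero, zero_mul, Complex.exp_zero, Complex.ofReal_mul,
    Complex.ofReal_ofNat, Complex.exp_two_pi_mul_I] at hconst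
  have h2 : (N : ℂ) * (2 * Real.pi * Complex.I) = 0 := by linear_combination hconst
  exact_mod_cast (mul_eq_zero.1 h2).resolve_right Complex.two_pi_I_ne_zero

theorem zpow_finsetSum₀ {ι : Type*} {z : ℂ} (hz : z ≠ 0) (s : Finset ι) (n : ι → ℤ) :
    z ^ ∑ i ∈ s, n i = ∏ i ∈ s, z ^ n i := by
  classical
  induction s using Finset.induction_on with
  | empty => simp
  | insert a s ha ih => rw [Finset.sum_insert ha, Finset.prod_insert ha, zpow_add₀ hz, ih]

theorem sum_eq_zero_of_hasLogOn_sphere {m : ℂ →₀ ℤ} {r : ℝ} (hr : 0 < r)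
    (hm : ∀ a ∈ m.support, ‖a‖ < r) (h : HasLogOn (ratProd m) (sphere 0 r)) :
    (m.sum fun _ n => n) = 0 := by
  refine eq_zero_of_hasLogOn_zpow_sphere hr ?_
  have h1 : HasLogOn (fun z => ∏ a ∈ m.support, ((z - a) / (z - 0)) ^ m a) (sphere 0 r) :=
    .prod _ fun a ha => (hasLogOn_sub_div_sub fun z hz => by
      simpa [mem_sphere_zero_iff_norm.1 hz] using hm a ha).zpow _
  refine (h.div h1).congr fun z hz => ?_
  have hz0 : z ≠ 0 := norm_pos_iff.1 (by rw [mem_sphere_zero_iff_norm.1 hz]; exact hr)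
  have hne : ratProd m z ≠ 0 := ratProd_ne_zero fun hmz =>
    (hm z hmz).ne (mem_sphere_zero_iff_norm.1 hz)
  have hpow : z ^ (m.sum fun _ n => n) = ∏ a ∈ m.support, z ^ m a :=
    zpow_finsetSum₀ hz0 _ _
  simp only [sub_zero, div_zpow, Finset.prod_div_distrib]
  rw [hpow, show ∏ a ∈ m.support, (z - a) ^ m a = ratProd m z from rfl, div_div_cancel₀ hne]

/-- If a rational function has a logarithm on a compact set, then its degree over any bounded open
set with frontier in the compact set vanishes. -/
theorem sum_filter_eq_zero_of_hasLogOn {K C : Set ℂ} (hK : IsClosed K) (hC : IsOpen C)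
    (hCb : Bornology.IsBounded C) (hCK : frontier C ⊆ K) {m : ℂ →₀ ℤ}
    (hm : ∀ a ∈ m.support, a ∉ K) (h : HasLogOn (ratProd m) K) [DecidablePred (· ∈ C)] :
    ((m.filter (· ∈ C)).sum fun _ n => n) = 0 := by
  obtain ⟨g, hg, hgf⟩ := h
  obtain ⟨G, hG, hGg⟩ := exists_continuous_extension hK hg
  obtain ⟨r, hr0, hr⟩ := hCb.subset_ball_lt 0 0
  set m₁ := m.filter (· ∈ C) with hm₁
  set m₂ := m.filter (fun a => ¬ a ∈ C) with hm₂
  have hs₁ : ∀ a ∈ m₁.support, a ∈ m.support ∧ a ∈ C := fun a ha => by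
    simpa [hm₁, Finsupp.support_filter] using ha
  have hs₂ : ∀ a ∈ m₂.support, a ∈ m.support ∧ a ∉ C := fun a ha => by
    simpa [hm₂, Finsupp.support_filter] using ha
  have hcl : ∀ z ∈ closure C, z ∉ C → z ∈ K := fun z hz hzC => hCK (by
    rw [hC.frontier_eq]; exact ⟨hz, hzC⟩)
  have hs₂' : ∀ a ∈ m₂.support, a ∉ closure C := fun a ha hac =>
    hm a (hs₂ a ha).1 (hcl a hac (hs₂ a ha).2)
  set F : ℂ → ℂ := C.piecewise (fun z => Complex.exp (G z) / ratProd m₂ z) (ratProd m₁) with hF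
  have hFC : ∀ z ∈ closure C, F z = Complex.exp (G z) / ratProd m₂ z := fun z hz => by
    by_cases hzC : z ∈ C
    · exact Set.piecewise_eq_of_mem _ _ _ hzC
    · have hzK := hcl z hz hzC
      have h₂ : z ∉ m₂.support := fun h => hs₂' z h hz
      rw [hF, Set.piecewise_eq_of_notMem _ _ _ hzC, hGg z hzK, hgf z hzK, eq_div_iff
        (ratProd_ne_zero h₂), ← ratProd_add (fun h => hzC (hs₁ z h).2) h₂,
        Finsupp.filter_add_filter_not]
  have hFC' : ∀ z ∈ Cᶜ, F z = ratProd m₁ z := fun z hz => Set.piecewise_eq_of_notMem _ _ _ hz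
  have hFcont : Continuous F := by
    have h1 : ContinuousOn F (closure C) :=
      ((Complex.continuous_exp.comp hG).continuousOn.div (continuousOn_ratProd hs₂')
        fun z hz => ratProd_ne_zero fun h => hs₂' z h hz).congr hFC
    have h2 : ContinuousOn F Cᶜ :=
      (continuousOn_ratProd fun a ha => Set.notMem_compl_iff.2 (hs₁ a ha).2).congr hFC'
    rw [← continuousOn_univ]
    refine (h1.union_of_isClosed h2 isClosed_closure hC.isClosed_compl).mono fun z _ => ?_
    by_cases hz : z ∈ C
    · exact .inl (subset_closure hz)
    · exact .inr hz
  have hF0 : ∀ z, F z ≠ 0 := fun z => by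
    by_cases hz : z ∈ C
    · rw [hFC z (subset_closure hz)]
      exact div_ne_zero (Complex.exp_ne_zero _) (ratProd_ne_zero fun h => (hs₂ z h).2 hz)
    · rw [hFC' z hz]
      exact ratProd_ne_zero fun h => hz (hs₁ z h).2
  refine sum_eq_zero_of_hasLogOn_sphere hr0
    (fun a ha => mem_ball_zero_iff.1 (hr (hs₁ a ha).2)) ?_
  refine ((hasLogOn_closedBall hFcont.continuousOn fun z _ => hF0 z).mono
    sphere_subset_closedBall).congr fun z hz => (hFC' z fun hzC => ?_).symm
  exact (mem_ball_zero_iff.1 (hr hzC)).ne (mem_sphere_zero_iff_norm.1 hz)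

/-- The points `b` off `K` for which `(z - b) / (z - a)` has a logarithm on `K`. -/
def logClass (K : Set ℂ) (a : ℂ) : Set ℂ :=
  {b | b ∉ K ∧ HasLogOn (fun z => (z - b) / (z - a)) K}

section logClass

variable {K : Set ℂ} {a b : ℂ}

theorem sub_div_sub_mul {b' z : ℂ} (h : z ≠ b) :
    (z - b') / (z - a) = (z - b') / (z - b) * ((z - b) / (z - a)) := by
  rw [div_mul_div_cancel₀ (sub_ne_zero.2 h)]

theorem self_mem_logClass (ha : a ∉ K) : a ∈ logClass K a :=
  ⟨ha, (HasLogOn.const one_ne_zero K).congr fun _ hz =>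
    div_self (sub_ne_zero.2 fun e => ha (e ▸ hz))⟩

theorem logClass_eq_of_mem (hb : b ∈ logClass K a) : logClass K b = logClass K a := by
  have hne : ∀ z ∈ K, z ≠ b := fun z hz e => hb.1 (e ▸ hz)
  ext x
  refine ⟨fun hx => ⟨hx.1, (hx.2.mul hb.2).congr fun z hz => sub_div_sub_mul (hne z hz)⟩,
    fun hx => ⟨hx.1, (hx.2.div hb.2).congr fun z hz => ?_⟩⟩
  by_cases hza : z - a = 0
  · obtain ⟨g, -, hg⟩ := hb.2
    have : Complex.exp (g z) = (z - b) / (z - a) := hg z hz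
    rw [hza, div_zero] at this
    exact absurd this (Complex.exp_ne_zero _)
  · rw [div_div_div_cancel_right₀ hza]

theorem exists_ball_subset_logClass (hK : IsClosed K) (ha : a ∉ K) :
    ∃ δ > 0, ∀ b ∈ ball a δ, b ∉ K ∧ a ∈ logClass K b := by
  obtain ⟨δ, hδ, hsub⟩ := Metric.isOpen_iff.1 hK.isOpen_compl a ha
  refine ⟨δ / 2, half_pos hδ, fun b hb => ⟨hsub (ball_subset_ball (by linarith) hb), ha,
    hasLogOn_sub_div_sub fun z hz => ?_⟩⟩
  have h1 : δ ≤ dist z a := not_lt.1 fun h => hsub h hz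
  have h2 : dist b a < δ / 2 := hb
  have h3 := dist_triangle z b a
  rw [← dist_eq_norm, ← dist_eq_norm]
  linarith

theorem mem_logClass_symm (ha : a ∉ K) (h : b ∈ logClass K a) : a ∈ logClass K b := by
  rw [logClass_eq_of_mem h]
  exact self_mem_logClass ha

theorem isOpen_logClass (hK : IsClosed K) : IsOpen (logClass K a) := by
  refine Metric.isOpen_iff.2 fun b hb => ?_
  obtain ⟨δ, hδ, h⟩ := exists_ball_subset_logClass hK hb.1
  refine ⟨δ, hδ, fun x hx => ?_⟩
  rw [← logClass_eq_of_mem hb]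
  exact mem_logClass_symm (h x hx).1 (h x hx).2

theorem frontier_logClass_subset (hK : IsClosed K) : frontier (logClass K a) ⊆ K := by
  intro x hx
  by_contra hxK
  rw [(isOpen_logClass hK).frontier_eq] at hx
  obtain ⟨δ, hδ, h⟩ := exists_ball_subset_logClass hK hxK
  obtain ⟨b, hb, hxb⟩ := Metric.mem_closure_iff.1 hx.1 δ hδ
  refine hx.2 ?_
  rw [← logClass_eq_of_mem hb]
  exact (h b (by rwa [mem_ball'])).2

theorem isBounded_logClass (hK : IsCompact K) (ha : ¬ HasLogOn (fun z => z - a) K) :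
    Bornology.IsBounded (logClass K a) := by
  obtain ⟨r, hr⟩ := hK.isBounded.subset_closedBall 0
  refine (isBounded_closedBall (x := (0 : ℂ)) (r := r)).subset fun b hb => ?_
  by_contra hbr
  rw [mem_closedBall_zero_iff, not_le] at hbr
  have h1 : HasLogOn (fun z => z - b) K :=
    hasLogOn_sub_of_norm_lt fun z hz => (mem_closedBall_zero_iff.1 (hr hz)).trans_lt hbr
  refine ha ((h1.div hb.2).congr fun z hz => ?_)
  rw [div_div_cancel₀ (sub_ne_zero.2 fun e : z = b => hb.1 (e ▸ hz))]

end logClass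

open Classical in
/-- A rational function all of whose class degrees vanish has a logarithm. -/
theorem hasLogOn_ratProd_of_sum_eq_zero {K : Set ℂ} {m : ℂ →₀ ℤ} (hm : ∀ a ∈ m.support, a ∉ K)
    (h : ∀ a ∉ K, ¬ HasLogOn (fun z => z - a) K →
      ((m.filter (· ∈ logClass K a)).sum fun _ n => n) = 0) : HasLogOn (ratProd m) K := by
  have hprod : ratProd m = fun z => ∏ C ∈ m.support.image (logClass K),
      ∏ a ∈ m.support with logClass K a = C, (z - a) ^ m a := by
    ext z
    exact (Finset.prod_fiberwise_of_maps_to (fun a ha => Finset.mem_image_of_mem _ ha) _).symm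
  rw [hprod]
  refine .prod _ fun C hC => ?_
  obtain ⟨a, ha, rfl⟩ := Finset.mem_image.1 hC
  have hfilter : {b ∈ m.support | logClass K b = logClass K a} =
      {b ∈ m.support | b ∈ logClass K a} :=
    Finset.filter_congr fun b hb => ⟨fun e => e ▸ self_mem_logClass (hm b hb), logClass_eq_of_mem⟩
  rw [hfilter]
  by_cases hlog : HasLogOn (fun z => z - a) K
  · refine .prod _ fun b hb => HasLogOn.zpow ?_ _
    refine ((Finset.mem_filter.1 hb).2.2.mul hlog).congr fun z hz => ?_
    rw [div_mul_cancel₀ _ (sub_ne_zero.2 fun e : z = a => hm a ha (e ▸ hz))]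
  · have h1 : HasLogOn (fun z => ∏ b ∈ m.support with b ∈ logClass K a,
        ((z - b) / (z - a)) ^ m b) K :=
      .prod _ fun b hb => (Finset.mem_filter.1 hb).2.2.zpow _
    refine h1.congr fun z hz => ?_
    have hza : z - a ≠ 0 := sub_ne_zero.2 fun e : z = a => hm a ha (e ▸ hz)
    have hdeg : ∑ b ∈ m.support with b ∈ logClass K a, m b = 0 := by
      rw [← h a (hm a ha) hlog, Finsupp.sum, Finsupp.support_filter]
      exact Finset.sum_congr rfl fun b hb =>
        (Finsupp.filter_apply_pos _ _ (Finset.mem_filter.1 hb).2).symm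
    have hpow : ∏ b ∈ m.support with b ∈ logClass K a, (z - a) ^ m b = 1 := by
      rw [← zpow_zero (z - a), ← hdeg]
      exact (zpow_finsetSum₀ hza _ _).symm
    simp only [div_zpow, Finset.prod_div_distrib, hpow, div_one]

/-- An infinitely divisible continuous nonvanishing function on a compact plane set has a
continuous logarithm. -/
theorem hasLogOn_of_forall_exists_pow_eq {K : Set ℂ} (hK : IsCompact K) {p : ℕ} (hp : 2 ≤ p)
    {f : ℂ → ℂ} (hf : ContinuousOn f K) (h0 : ∀ z ∈ K, f z ≠ 0)
    (hroot : ∀ n : ℕ, ∃ h : ℂ → ℂ, ContinuousOn h K ∧ ∀ z ∈ K, h z ^ p ^ n = f z) :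
    HasLogOn f K := by
  classical
  obtain ⟨m, hm, hfm⟩ := exists_ratProd_hasLogOn_div hK hf h0
  suffices H : HasLogOn (ratProd m) K from
    (hfm.mul H).congr fun z hz => (div_mul_cancel₀ _ (ratProd_ne_zero fun h => hm z h hz)).symm
  refine hasLogOn_ratProd_of_sum_eq_zero hm fun a _ ha => ?_
  set D : (ℂ →₀ ℤ) → ℤ := fun k => (k.filter (· ∈ logClass K a)).sum fun _ n => n with hD
  have hDadd : ∀ k l, D (k + l) = D k + D l := fun k l => by
    simp only [hD, Finsupp.filter_add]
    exact Finsupp.sum_add_index' (fun _ => rfl) fun _ _ _ => rfl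
  have hDsmul : ∀ (q : ℤ) k, D (q • k) = q * D k := fun q k => by
    simp only [hD, Finsupp.filter_smul]
    rw [Finsupp.sum_smul_index (fun _ => rfl), Finsupp.mul_sum]
  have hdvd : ∀ n : ℕ, ((p : ℤ) ^ n) ∣ D m := fun n => by
    obtain ⟨h, hh, hhf⟩ := hroot n
    have hh0 : ∀ z ∈ K, h z ≠ 0 := fun z hz e => h0 z hz (by
      rw [← hhf z hz, e, zero_pow (pow_pos (by omega) n).ne'])
    obtain ⟨k, hk, hhk⟩ := exists_ratProd_hasLogOn_div hK hh hh0
    have hsupp₁ : ∀ b ∈ (((p : ℤ) ^ n) • k).support, b ∉ K := fun b hb =>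
      hk b (Finsupp.support_smul hb)
    have hsupp₂ : ∀ b ∈ ((-1 : ℤ) • m).support, b ∉ K := fun b hb =>
      hm b (Finsupp.support_smul hb)
    have hlog : HasLogOn (ratProd (((p : ℤ) ^ n) • k + (-1 : ℤ) • m)) K := by
      refine (hfm.div (hhk.zpow ((p : ℤ) ^ n))).congr fun z hz => ?_
      rw [ratProd_add (fun h => hsupp₁ z h hz) fun h => hsupp₂ z h hz, ratProd_zsmul,
        ratProd_zsmul, div_zpow, ← hhf z hz]
      have e1 : h z ^ ((p : ℤ) ^ n) = h z ^ p ^ n := by exact_mod_cast zpow_natCast (h z) (p ^ n)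
      have e2 : h z ^ p ^ n ≠ 0 := pow_ne_zero _ (hh0 z hz)
      have e3 : ratProd k z ^ ((p : ℤ) ^ n) ≠ 0 :=
        zpow_ne_zero _ (ratProd_ne_zero fun h => hk z h hz)
      have e4 : ratProd m z ≠ 0 := ratProd_ne_zero fun h => hm z h hz
      rw [e1, zpow_neg_one]
      field_simp
    have hzero := sum_filter_eq_zero_of_hasLogOn hK.isClosed (isOpen_logClass hK.isClosed)
      (isBounded_logClass hK ha) (frontier_logClass_subset hK.isClosed) (fun b hb => by
        rcases Finset.mem_union.1 (Finsupp.support_add hb) with h | h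
        exacts [hsupp₁ b h, hsupp₂ b h]) hlog
    change D _ = 0 at hzero
    rw [hDadd, hDsmul, hDsmul] at hzero
    exact ⟨D k, by linarith⟩
  change D m = 0
  by_contra hne
  have hlt : (D m).natAbs < p ^ (D m).natAbs := Nat.lt_pow_self (by omega)
  have hle := Int.natAbs_dvd_natAbs.2 (hdvd (D m).natAbs)
  rw [Int.natAbs_pow, Int.natAbs_natCast] at hle
  exact hlt.not_ge (Nat.le_of_dvd (Int.natAbs_pos.2 hne) hle)

instance (p : ℕ) : CompactSpace (Solenoid p) := by
  have : CompactSpace {w : ℂ // ‖w‖ = 1} := 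
    isCompact_iff_compactSpace (s := {w : ℂ | ‖w‖ = 1}).1 (by
      simpa [sphere, dist_zero_right] using isCompact_sphere (0 : ℂ) 1)
  refine isCompact_iff_compactSpace (s := {z : ℕ → {w : ℂ // ‖w‖ = 1} |
    ∀ n : ℕ, ((z (n + 1) : ℂ)) ^ p = (z n : ℂ)}).1 (IsClosed.isCompact ?_)
  simp only [Set.ofPred_forall]
  refine isClosed_iInter fun n => isClosed_eq ?_ ?_
  · exact (continuous_subtype_val.comp (continuous_apply (n + 1))).pow p
  · exact continuous_subtype_val.comp (continuous_apply n)

namespace Solenoid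

variable {p : ℕ}

/-- The `n`-th coordinate of a point of the solenoid. -/
def coord (n : ℕ) (x : Solenoid p) : ℂ := (x.1 n : ℂ)

theorem continuous_coord (n : ℕ) : Continuous (coord n : Solenoid p → ℂ) :=
  continuous_subtype_val.comp ((continuous_apply n).comp continuous_subtype_val)

theorem norm_coord (n : ℕ) (x : Solenoid p) : ‖coord n x‖ = 1 := (x.1 n).2

theorem coord_pow (n : ℕ) (x : Solenoid p) : coord n x ^ p ^ n = coord 0 x := by
  induction n with
  | zero => simp
  | succ n ih => rw [pow_succ', pow_mul, show coord (n + 1) x ^ p = coord n x from x.2 n, ih]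

/-- The dense line `t ↦ (exp (i t / p ^ n))` in the solenoid. -/
noncomputable def leaf (hp : p ≠ 0) (t : ℝ) : Solenoid p :=
  ⟨fun n => ⟨Complex.exp ((t / p ^ n : ℝ) * Complex.I), Complex.norm_exp_ofReal_mul_I _⟩,
    fun n => by
      have : (p : ℂ) ≠ 0 := Nat.cast_ne_zero.2 hp
      rw [← Complex.exp_nat_mul]
      congr 1
      push_cast
      field_simp
      ring⟩

theorem continuous_leaf (hp : p ≠ 0) : Continuous (leaf hp) :=
  Continuous.subtype_mk (continuous_pi fun _ => Continuous.subtype_mk (by fun_prop) _) _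

theorem coord_zero_leaf (hp : p ≠ 0) (t : ℝ) :
    coord 0 (leaf hp t) = Complex.exp (t * Complex.I) := by
  simp [coord, leaf]

theorem not_isEmbedding_complex (hp : 2 ≤ p) (e : Solenoid p → ℂ) : ¬ IsEmbedding e := by
  intro he
  have hp0 : p ≠ 0 := by omega
  have hK : IsCompact (Set.range e) := isCompact_range he.continuous
  have : Nonempty (Solenoid p) := ⟨leaf hp0 0⟩
  have hinv : ∀ x, Function.invFun e (e x) = x := Function.leftInverse_invFun he.injective
  have hcont : ∀ n, ContinuousOn (fun z => coord n (Function.invFun e z)) (Set.range e) :=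
    fun n => by
    rw [continuousOn_iff_continuous_domRestrict, ← he.toHomeomorph.comp_continuous_iff']
    refine (continuous_coord n).congr fun x => ?_
    exact congrArg (coord n) (hinv x).symm
  obtain ⟨g, hg, hgf⟩ := hasLogOn_of_forall_exists_pow_eq hK hp (hcont 0)
    (fun z _ => norm_ne_zero_iff.1 (by rw [norm_coord]; exact one_ne_zero))
    fun n => ⟨_, hcont n, fun z _ => coord_pow n _⟩
  have hconst := eq_of_exp_eq_one (φ := fun t => g (e (leaf hp0 t)) - t * Complex.I)
    ((hg.comp_continuous (he.continuous.comp (continuous_leaf hp0))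
      fun t => Set.mem_range_self _).sub (by fun_prop)) fun t => by
    rw [Complex.exp_sub, hgf _ (Set.mem_range_self _)]
    dsimp only
    rw [hinv, coord_zero_leaf, div_self (Complex.exp_ne_zero _)]
  obtain ⟨M, hM⟩ := (hK.image_of_continuousOn hg).isBounded.exists_norm_le
  have hbound : ∀ t, ‖g (e (leaf hp0 t))‖ ≤ M := fun t =>
    hM _ (Set.mem_image_of_mem g (Set.mem_range_self _))
  have ht := hconst (2 * M + 1) 0
  have hM0 : 0 ≤ M := (norm_nonneg _).trans (hbound 0)
  have hnorm : ‖((2 * M + 1 : ℝ) : ℂ) * Complex.I‖ = 2 * M + 1 := by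
    rw [norm_mul, Complex.norm_I, mul_one, Complex.norm_real, Real.norm_of_nonneg (by linarith)]
  have heq : ((2 * M + 1 : ℝ) : ℂ) * Complex.I =
      g (e (leaf hp0 (2 * M + 1))) - g (e (leaf hp0 0)) := by
    simp only [Complex.ofReal_zero, zero_mul, sub_zero] at ht
    linear_combination -ht
  rw [heq] at hnorm
  linarith [norm_sub_le (g (e (leaf hp0 (2 * M + 1)))) (g (e (leaf hp0 0))),
    hbound (2 * M + 1), hbound 0]

end Solenoid

/-- The `p`-adic solenoid admits no topological embedding into the plane. -/
theorem stmt7 (p : ℕ) (hp : 2 ≤ p) :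
    ¬ ∃ f : Solenoid p → EuclideanSpace ℝ (Fin 2), IsEmbedding f := by
  rintro ⟨f, hf⟩
  exact Solenoid.not_isEmbedding_complex hp _
    (Complex.orthonormalBasisOneI.repr.symm.toHomeomorph.isEmbedding.comp hf)
end

section
/- Let p be a prime and let Q_p = ℤ_p/ℤ be the quotient of the additive group of p-adic integers by the subgroup given by the image of the canonical inclusion ℤ → ℤ_p. Then Q_p is the internal direct sum of two subgroups A and B, where A is torsion-free (no nonzero element of A has finite additive order) and uncountable, and B is isomorphic to ℤ_(p)/ℤ, where ℤ_(p) = {q ∈ ℚ : the denominator of q is not divisible by p} is the localization of ℤ at p, viewed as an additive subgroup of ℚ containing ℤ. -/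
/-- The localization `ℤ_(p) = {q ∈ ℚ : p ∤ den(q)}` of `ℤ` at `p`, as an additive
subgroup of `ℚ`. -/
def zLocal (p : ℕ) [hp : Fact p.Prime] : AddSubgroup ℚ where
  carrier := {q : ℚ | ¬ p ∣ q.den}
  zero_mem' := by
    simp only [Set.mem_setOf_eq, Rat.den_zero, Nat.dvd_one]
    exact hp.out.ne_one
  add_mem' := by
    intro a b ha hb hd
    rcases (hp.out.dvd_mul.mp (hd.trans (Rat.add_den_dvd a b))) with h | h
    · exact ha h
    · exact hb h
  neg_mem' := by
    intro a ha
    simpa only [Set.mem_setOf_eq, Rat.den_neg_eq_den] using ha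

theorem mem_zLocal_iff_norm_le_one (p : ℕ) [Fact p.Prime] (q : ℚ) :
    q ∈ zLocal p ↔ ‖(q : ℚ_[p])‖ ≤ 1 := by
  refine ⟨fun h => Padic.norm_rat_le_one h, fun h hd => ?_⟩
  have hu := PadicInt.isUnit_iff.mp (PadicInt.isUnit_den q h)
  have hlt : ‖((q.den : ℤ) : ℤ_[p])‖ < 1 :=
    (PadicInt.norm_int_lt_one_iff_dvd _).2 (Int.natCast_dvd_natCast.2 hd)
  rw [Int.cast_natCast, hu] at hlt
  exact lt_irrefl _ hlt

/-- The canonical inclusion `ℤ_(p) → ℤ_p`. -/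
noncomputable def zLocalToPadicInt (p : ℕ) [Fact p.Prime] : zLocal p →+ ℤ_[p] where
  toFun q := ⟨((q : ℚ) : ℚ_[p]), (mem_zLocal_iff_norm_le_one p q).1 q.2⟩
  map_zero' := PadicInt.ext (by simp)
  map_add' a b := PadicInt.ext (Rat.cast_add _ _)

@[simp]
theorem coe_zLocalToPadicInt (p : ℕ) [Fact p.Prime] (q : zLocal p) :
    (zLocalToPadicInt p q : ℚ_[p]) = ((q : ℚ) : ℚ_[p]) := rfl

/-- The quotient `ℤ_(p)/ℤ`. -/
abbrev ZLocalModInt (p : ℕ) [Fact p.Prime] : Type :=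
  zLocal p ⧸ ((Int.castAddHom ℚ).range.addSubgroupOf (zLocal p))

/-- The quotient `ℤ_p/ℤ`. -/
abbrev PadicIntModInt (p : ℕ) [Fact p.Prime] : Type :=
  ℤ_[p] ⧸ (Int.castAddHom ℤ_[p]).range

theorem zLocalToPadicInt_mem_range_iff (p : ℕ) [Fact p.Prime] (q : zLocal p) :
    zLocalToPadicInt p q ∈ (Int.castAddHom ℤ_[p]).range ↔
      q ∈ (Int.castAddHom ℚ).range.addSubgroupOf (zLocal p) := by
  simp only [AddSubgroup.mem_addSubgroupOf, AddMonoidHom.mem_range, Int.coe_castAddHom]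
  refine exists_congr fun n => ?_
  refine Subtype.coe_injective.eq_iff.symm.trans ?_
  rw [PadicInt.coe_intCast, coe_zLocalToPadicInt]
  exact_mod_cast Iff.rfl

/-- The map `ℤ_(p)/ℤ → ℤ_p/ℤ` induced by the canonical inclusion. -/
noncomputable def zLocalModIntToPadic (p : ℕ) [Fact p.Prime] :
    ZLocalModInt p →+ PadicIntModInt p :=
  QuotientAddGroup.map _ _ (zLocalToPadicInt p)
    fun q hq => (zLocalToPadicInt_mem_range_iff p q).2 hq

theorem zLocalModIntToPadic_mk (p : ℕ) [Fact p.Prime] (q : zLocal p) :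
    zLocalModIntToPadic p (q : ZLocalModInt p) = (zLocalToPadicInt p q : PadicIntModInt p) := rfl

theorem zLocalModIntToPadic_injective (p : ℕ) [Fact p.Prime] :
    Function.Injective (zLocalModIntToPadic p) := by
  rw [injective_iff_map_eq_zero]
  intro x hx
  induction x using QuotientAddGroup.induction_on with
  | H q =>
    rw [zLocalModIntToPadic_mk, QuotientAddGroup.eq_zero_iff] at hx
    exact (QuotientAddGroup.eq_zero_iff q).2 ((zLocalToPadicInt_mem_range_iff p q).1 hx)

theorem zLocalModInt_zsmul_surjective (p : ℕ) [Fact p.Prime] {n : ℤ} (hn : n ≠ 0) :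
    Function.Surjective (fun x : ZLocalModInt p => n • x) := by
  intro x
  induction x using QuotientAddGroup.induction_on with
  | H q =>
    have hn' : (n : ℚ_[p]) ≠ 0 := Int.cast_ne_zero.2 hn
    obtain ⟨c, hc⟩ := PadicInt.denseRange_intCast.exists_dist_lt
      (zLocalToPadicInt p q) (norm_pos_iff.2 hn')
    have hy : ((q : ℚ) - c) / n ∈ zLocal p := by
      rw [mem_zLocal_iff_norm_le_one]
      push_cast
      rw [norm_div, div_le_one (norm_pos_iff.2 hn')]
      rw [dist_eq_norm, PadicInt.norm_def] at hc
      simpa using hc.le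
    refine ⟨((⟨_, hy⟩ : zLocal p) : ZLocalModInt p), ?_⟩
    change ((n • (⟨_, hy⟩ : zLocal p) : zLocal p) : ZLocalModInt p) = _
    rw [QuotientAddGroup.eq, AddSubgroup.mem_addSubgroupOf]
    refine ⟨c, ?_⟩
    have hnq : (n : ℚ) ≠ 0 := Int.cast_ne_zero.2 hn
    simp only [Int.coe_castAddHom, AddSubgroup.coe_add, AddSubgroup.coe_neg,
      AddSubgroup.coe_zsmul, zsmul_eq_mul]
    field_simp
    ring

theorem mem_range_zLocalModIntToPadic_of_isOfFinAddOrder (p : ℕ) [Fact p.Prime]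
    {x : PadicIntModInt p} (hx : IsOfFinAddOrder x) : x ∈ (zLocalModIntToPadic p).range := by
  obtain ⟨n, hn, hnx⟩ := isOfFinAddOrder_iff_nsmul_eq_zero.1 hx
  induction x using QuotientAddGroup.induction_on with
  | H z =>
    change ((n • z : ℤ_[p]) : PadicIntModInt p) = 0 at hnx
    obtain ⟨k, hk⟩ := (QuotientAddGroup.eq_zero_iff _).1 hnx
    have hk' : (k : ℚ_[p]) = n * (z : ℚ_[p]) := by
      simpa using congrArg (fun w : ℤ_[p] => (w : ℚ_[p])) hk
    have hn' : (n : ℚ_[p]) ≠ 0 := Nat.cast_ne_zero.2 hn.ne'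
    have hz : (((k : ℚ) / n : ℚ) : ℚ_[p]) = z := by
      push_cast
      rw [hk', mul_div_cancel_left₀ _ hn']
    have hq : (k : ℚ) / n ∈ zLocal p := by
      rw [mem_zLocal_iff_norm_le_one, hz]
      exact z.2
    refine ⟨((⟨_, hq⟩ : zLocal p) : ZLocalModInt p), ?_⟩
    rw [zLocalModIntToPadic_mk]
    exact congrArg _ (PadicInt.ext hz)

theorem PadicInt.not_countable (p : ℕ) [Fact p.Prime] : ¬ Countable ℤ_[p] := by
  intro h
  have hball := continuum_le_cardinal_of_isOpen ℚ_[p]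
    (Metric.isOpen_ball (x := (0 : ℚ_[p])) (ε := 1)) ⟨0, by simp⟩
  have hsub : Metric.ball (0 : ℚ_[p]) 1 ⊆ Set.range ((↑) : ℤ_[p] → ℚ_[p]) := fun x hx =>
    ⟨⟨x, (mem_ball_zero_iff.1 hx).le⟩, rfl⟩
  have hcount := Cardinal.le_aleph0_iff_set_countable.2
    ((@Set.countable_range _ _ h ((↑) : ℤ_[p] → ℚ_[p])).mono hsub)
  exact (hball.trans hcount).not_gt Cardinal.aleph0_lt_continuum

theorem not_countable_padicIntModInt (p : ℕ) [Fact p.Prime] :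
    ¬ Countable (PadicIntModInt p) := by
  intro h
  have : Countable (Int.castAddHom ℤ_[p]).range :=
    (Set.countable_range (Int.castAddHom ℤ_[p])).to_subtype
  exact PadicInt.not_countable p
    (AddSubgroup.addGroupEquivQuotientProdAddSubgroup
      (s := (Int.castAddHom ℤ_[p]).range)).injective.countable

/-- Example 2.3: `Q_p = ℤ_p/ℤ` is the internal direct sum of a torsion-free uncountable
subgroup and a subgroup isomorphic to `ℤ_(p)/ℤ`. -/
theorem stmt10 (p : ℕ) [Fact p.Prime] :
    ∃ A B : AddSubgroup (ℤ_[p] ⧸ (Int.castAddHom ℤ_[p]).range),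
      A ⊓ B = ⊥ ∧ A ⊔ B = ⊤ ∧
      (∀ x ∈ A, x ≠ 0 → ¬ IsOfFinAddOrder x) ∧
      ¬ (A : Set (ℤ_[p] ⧸ (Int.castAddHom ℤ_[p]).range)).Countable ∧
      Nonempty (B ≃+
        (zLocal p ⧸ ((Int.castAddHom ℚ).range.addSubgroupOf (zLocal p)))) := by
  let f := zLocalModIntToPadic p
  have hf : Function.Injective f := zLocalModIntToPadic_injective p
  let : DivisibleBy (ZLocalModInt p) ℤ :=
    divisibleByOfSMulRightSurj _ _ fun hn => zLocalModInt_zsmul_surjective p hn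
  obtain ⟨g, hg⟩ := (Module.Baer.of_divisible (ZLocalModInt p)).extension_property_addMonoidHom
    f hf (AddMonoidHom.id _)
  have hgf : ∀ d, g (f d) = d := DFunLike.congr_fun hg
  have hinf : ∀ x ∈ g.ker, x ∈ f.range → x = 0 := by
    rintro _ hx ⟨d, rfl⟩
    rw [AddMonoidHom.mem_ker, hgf] at hx
    rw [hx, map_zero]
  have hker : ∀ x, x - f (g x) ∈ g.ker := fun x => by
    rw [AddMonoidHom.mem_ker, map_sub, hgf, sub_self]
  refine ⟨g.ker, f.range, ?_, ?_, ?_, ?_, ⟨(AddMonoidHom.ofInjective hf).symm⟩⟩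
  · exact (AddSubgroup.eq_bot_iff_forall _).2 fun x hx => hinf x hx.1 hx.2
  · refine eq_top_iff.2 fun x _ => ?_
    rw [← sub_add_cancel x (f (g x))]
    exact AddSubgroup.add_mem_sup (hker x) ⟨g x, rfl⟩
  · exact fun x hx hx0 hfin =>
      hx0 (hinf x hx (mem_range_zLocalModIntToPadic_of_isOfFinAddOrder p hfin))
  · intro hA
    have : Countable g.ker := hA.to_subtype
    have : Countable (ZLocalModInt p) := (QuotientAddGroup.mk_surjective).countable
    refine not_countable_padicIntModInt p (Function.Injective.countable
      (f := fun x => ((⟨_, hker x⟩ : g.ker), g x)) fun x y hxy => ?_)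
    obtain ⟨h₁, h₂⟩ := Prod.ext_iff.1 hxy
    have h₁' : x - f (g x) = y - f (g y) := congrArg Subtype.val h₁
    have h₂' : g x = g y := h₂
    rwa [h₂', sub_left_inj] at h₁'
end
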